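/- Let G be a finite simple connected graph of order n ≥ 3. Then λ(G) = n − 2 if and only if η(G) = n − 2. -/

import Mathlib

open SimpleGraph

variable {V : Type*}

/-- `D` is a dominating set of `G`: every vertex outside `D` has a neighbor in `D`. -/
def Dominating (G : SimpleGraph V) (D : Set V) : Prop :=
  ∀ v ∉ D, ∃ u ∈ D, G.Adj u v

/-- `S` is a locating set of `G`: distinct vertices have distinct vectors of
distances to the vertices of `S`. -/
def Locating (G : SimpleGraph V) (S : Set V) : Prop :=
  ∀ u v : V, u ≠ v → ∃ x ∈ S, G.dist u x ≠ G.dist v x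

/-- `D` is a locating-dominating set of `G`: it is dominating and distinct vertices
outside `D` have distinct (nonempty) neighborhoods within `D`. -/
def LocatingDominating (G : SimpleGraph V) (D : Set V) : Prop :=
  Dominating G D ∧
  ∀ u ∉ D, ∀ v ∉ D, u ≠ v → (G.neighborSet u ∩ D) ≠ (G.neighborSet v ∩ D)

/-- The domination number `γ(G)`. -/
noncomputable def domNum (G : SimpleGraph V) : ℕ :=
  sInf {k | ∃ D : Set V, Dominating G D ∧ D.ncard = k}

/-- The metric dimension `β(G)`. -/
noncomputable def metricDim (G : SimpleGraph V) : ℕ :=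
  sInf {k | ∃ S : Set V, Locating G S ∧ S.ncard = k}

/-- The metric-location-domination number `η(G)`. -/
noncomputable def mldNum (G : SimpleGraph V) : ℕ :=
  sInf {k | ∃ S : Set V, Dominating G S ∧ Locating G S ∧ S.ncard = k}

/-- The location-domination number `λ(G)`. -/
noncomputable def locDomNum (G : SimpleGraph V) : ℕ :=
  sInf {k | ∃ D : Set V, LocatingDominating G D ∧ D.ncard = k}

theorem SimpleGraph.Connected.exists_adj_dist_add_one_eq {G : SimpleGraph V} (hG : G.Connected)
    {a x : V} (hne : a ≠ x) : ∃ b, G.Adj a b ∧ G.dist b x + 1 = G.dist a x := by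
  obtain ⟨p, hp⟩ := hG.exists_walk_length_eq_dist a x
  cases p with
  | nil => exact absurd rfl hne
  | @cons _ b _ h q =>
    refine ⟨b, h, ?_⟩
    have hq := dist_le q
    have htri := hG.dist_triangle (u := a) (v := b) (w := x)
    rw [dist_eq_one_iff_adj.2 h] at htri
    rw [Walk.length_cons] at hp
    omega

theorem SimpleGraph.Connected.dist_le_dist_add_one {G : SimpleGraph V} (hG : G.Connected)
    {a b : V} (h : G.Adj a b) (x : V) : G.dist a x ≤ G.dist b x + 1 := by
  have htri := hG.dist_triangle (u := a) (v := b) (w := x)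
  rw [dist_eq_one_iff_adj.2 h] at htri
  omega

theorem Dominating.mono {G : SimpleGraph V} {S T : Set V} (h : Dominating G S) (hST : S ⊆ T) :
    Dominating G T := fun v hv =>
  let ⟨u, hu, huv⟩ := h v fun hvS => hv (hST hvS)
  ⟨u, hST hu, huv⟩

theorem Locating.mono {G : SimpleGraph V} {S T : Set V} (h : Locating G S) (hST : S ⊆ T) :
    Locating G T := fun u v huv =>
  let ⟨x, hx, hne⟩ := h u v huv
  ⟨x, hST hx, hne⟩

theorem LocatingDominating.locating {G : SimpleGraph V} (hG : G.Connected) {D : Set V}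
    (h : LocatingDominating G D) : Locating G D := by
  intro u v huv
  by_cases hu : u ∈ D
  · refine ⟨u, hu, ?_⟩
    rw [dist_self]
    exact (hG.pos_dist_of_ne huv.symm).ne
  by_cases hv : v ∈ D
  · refine ⟨v, hv, ?_⟩
    rw [dist_self]
    exact (hG.pos_dist_of_ne huv).ne'
  by_contra! hdist
  refine h.2 u hu v hv huv ?_
  ext x
  simp only [Set.mem_inter_iff, mem_neighborSet, and_congr_left_iff]
  intro hx
  rw [← dist_eq_one_iff_adj, ← dist_eq_one_iff_adj, hdist x hx]

/-- The complement of `{u, v, y}`, where `y` is the second vertex of a shortest path from `u` to a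
vertex `x` of `S` that is closer to `u` than to `v`, is locating-dominating. -/
theorem exists_locatingDominating_of_dist_lt [Finite V] {G : SimpleGraph V} (hG : G.Connected)
    {S : Set V} (hdom : Dominating G S) (hcard : Sᶜ.ncard ≤ 3) {u v x : V} (hu : u ∉ S)
    (hv : v ∉ S) (hN : G.neighborSet u ∩ S = G.neighborSet v ∩ S) (hx : x ∈ S)
    (hlt : G.dist u x < G.dist v x) :
    ∃ D : Set V, LocatingDominating G D ∧ D.ncard = S.ncard := by
  have hN' : ∀ s ∈ S, (G.Adj u s ↔ G.Adj v s) := fun s hs => by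
    simpa [hs] using Set.ext_iff.1 hN s
  have huv : u ≠ v := by rintro rfl; exact hlt.false
  have hux : u ≠ x := by rintro rfl; exact hu hx
  obtain ⟨w, huw, hwx⟩ := hG.exists_adj_dist_add_one_eq hux
  have hvw : ¬ G.Adj v w := fun h => by
    have := hG.dist_le_dist_add_one h x
    omega
  have hwS : w ∉ S := fun h => hvw ((hN' w h).1 huw)
  have hwv : w ≠ v := by rintro rfl; omega
  have hScompl : {u, v, w} = Sᶜ := by
    refine Set.eq_of_subset_of_ncard_le ?_ ?_
    · rintro a (rfl | rfl | rfl) <;> assumption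
    · rwa [Set.ncard_eq_three.2 ⟨u, v, w, huv, huw.ne, hwv.symm, rfl⟩]
  have hwne : w ≠ x := by rintro rfl; exact hwS hx
  obtain ⟨y, hwy, hyx⟩ := hG.exists_adj_dist_add_one_eq hwne
  have hyu : y ≠ u := by rintro rfl; omega
  have hyv : y ≠ v := by rintro rfl; omega
  have hyS : y ∈ S := by
    by_contra h
    have : y ∈ ({u, v, w} : Set V) := hScompl ▸ h
    rcases this with rfl | rfl | rfl
    · exact hyu rfl
    · exact hyv rfl
    · exact hwy.ne rfl
  have huy : ¬ G.Adj u y := fun h => by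
    have := hG.dist_le_dist_add_one h x
    omega
  obtain ⟨s, hs, hsv⟩ := hdom v hv
  have hsu : G.Adj s u := ((hN' s hs).2 hsv.symm).symm
  have hsy : s ≠ y := by rintro rfl; exact huy hsu.symm
  have hw : w ∈ ({u, v, y} : Set V)ᶜ := by simp [huw.ne', hwv, hwy.ne]
  have hsD : s ∈ ({u, v, y} : Set V)ᶜ := by simp [hsu.ne, hsv.ne, hsy]
  have huy_sep : ∃ z ∈ ({u, v, y} : Set V)ᶜ, ¬ (G.Adj u z ↔ G.Adj y z) := by
    by_cases hyx' : y = x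
    · subst hyx'
      refine ⟨s, hsD, fun h => ?_⟩
      have h1 := hG.dist_le_dist_add_one hsv.symm y
      have h2 := dist_eq_one_iff_adj.2 (h.1 hsu.symm).symm
      have h3 := G.dist_self (v := y)
      omega
    · obtain ⟨z, hyz, hzx⟩ := hG.exists_adj_dist_add_one_eq hyx'
      have hzu : z ≠ u := by rintro rfl; omega
      have hzv : z ≠ v := by rintro rfl; omega
      refine ⟨z, by simp [hzu, hzv, hyz.ne'], fun h => ?_⟩
      have := hG.dist_le_dist_add_one (h.2 hyz) x
      omega
  have hsep : ∀ {a b : V}, (∃ z ∈ ({u, v, y} : Set V)ᶜ, ¬ (G.Adj a z ↔ G.Adj b z)) →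
      G.neighborSet a ∩ ({u, v, y} : Set V)ᶜ ≠ G.neighborSet b ∩ ({u, v, y} : Set V)ᶜ := by
    rintro a b ⟨z, hz, hne⟩ heq
    refine hne ?_
    have := Set.ext_iff.1 heq z
    simpa only [Set.mem_inter_iff, hz, and_true, mem_neighborSet] using this
  have hsep_uv := hsep ⟨w, hw, fun h => hvw (h.1 huw)⟩
  have hsep_yv := hsep ⟨w, hw, fun h => hvw (h.1 hwy.symm)⟩
  have hsep_uy := hsep huy_sep
  refine ⟨({u, v, y} : Set V)ᶜ, ⟨fun a ha => ?_, fun a ha b hb hab => ?_⟩, ?_⟩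
  · rcases Set.notMem_compl_iff.1 ha with rfl | rfl | rfl
    · exact ⟨w, hw, huw.symm⟩
    · exact ⟨s, hsD, hsv⟩
    · exact ⟨w, hw, hwy⟩
  · rcases Set.notMem_compl_iff.1 ha with rfl | rfl | rfl <;>
      rcases Set.notMem_compl_iff.1 hb with rfl | rfl | rfl <;>
      first
        | exact absurd rfl hab
        | assumption
        | exact Ne.symm ‹_›
  · have h1 := Set.ncard_add_ncard_compl S
    have h2 := Set.ncard_add_ncard_compl ({u, v, y} : Set V)
    rw [← hScompl, Set.ncard_eq_three.2 ⟨u, v, w, huv, huw.ne, hwv.symm, rfl⟩] at h1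
    rw [Set.ncard_eq_three.2 ⟨u, v, y, huv, hyu.symm, hyv.symm, rfl⟩] at h2
    omega

theorem exists_locatingDominating_ncard_eq [Finite V] {G : SimpleGraph V} (hG : G.Connected)
    {S : Set V} (hdom : Dominating G S) (hloc : Locating G S) (hcard : Sᶜ.ncard ≤ 3) :
    ∃ D : Set V, LocatingDominating G D ∧ D.ncard = S.ncard := by
  by_cases hLD : LocatingDominating G S
  · exact ⟨S, hLD, rfl⟩
  simp only [LocatingDominating, hdom, true_and, not_forall, not_not] at hLD
  obtain ⟨u, hu, v, hv, huv, hN⟩ := hLD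
  obtain ⟨x, hx, hne⟩ := hloc u v huv
  rcases hne.lt_or_gt with hlt | hlt
  · exact exists_locatingDominating_of_dist_lt hG hdom hcard hu hv hN hx hlt
  · exact exists_locatingDominating_of_dist_lt hG hdom hcard hv hu hN.symm hx hlt

theorem exists_mldNum (G : SimpleGraph V) (hG : G.Connected) :
    ∃ S : Set V, Dominating G S ∧ Locating G S ∧ S.ncard = mldNum G := by
  refine Nat.sInf_mem (s := {k | ∃ S : Set V, Dominating G S ∧ Locating G S ∧ S.ncard = k})
    ⟨_, Set.univ, fun v hv => absurd trivial hv, fun u v huv => ⟨u, trivial, ?_⟩, rfl⟩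
  rw [dist_self]
  exact (hG.pos_dist_of_ne huv.symm).ne

theorem exists_locDomNum (G : SimpleGraph V) :
    ∃ D : Set V, LocatingDominating G D ∧ D.ncard = locDomNum G :=
  Nat.sInf_mem (s := {k | ∃ D : Set V, LocatingDominating G D ∧ D.ncard = k})
    ⟨_, Set.univ, ⟨fun _ hv => absurd trivial hv, fun _ hu => absurd trivial hu⟩, rfl⟩

theorem mldNum_le_locDomNum (G : SimpleGraph V) (hG : G.Connected) :
    mldNum G ≤ locDomNum G := by
  obtain ⟨D, hD, hcard⟩ := exists_locDomNum G
  exact Nat.sInf_le ⟨D, hD.1, hD.locating hG, hcard⟩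

theorem locDomNum_le_of_mldNum_le [Fintype V] {G : SimpleGraph V} (hG : G.Connected) {k : ℕ}
    (hk : mldNum G ≤ k) (hkV : k ≤ Fintype.card V) (hVk : Fintype.card V ≤ k + 3) :
    locDomNum G ≤ k := by
  obtain ⟨S, hdom, hloc, hS⟩ := exists_mldNum G hG
  obtain ⟨T, hST, -, hT⟩ := Set.exists_subsuperset_card_eq (Set.subset_univ S) (hS.trans_le hk)
    (by rwa [Set.ncard_univ, Nat.card_eq_fintype_card])
  have hTc := Set.ncard_add_ncard_compl T
  rw [Nat.card_eq_fintype_card] at hTc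
  obtain ⟨D, hD, hDT⟩ :=
    exists_locatingDominating_ncard_eq hG (hdom.mono hST) (hloc.mono hST) (by omega)
  exact Nat.sInf_le ⟨D, hD, hDT.trans hT⟩

theorem stmt11 [Fintype V] (G : SimpleGraph V) (hG : G.Connected)
    (hn : 3 ≤ Fintype.card V) :
    locDomNum G = Fintype.card V - 2 ↔ mldNum G = Fintype.card V - 2 := by
  have hle := mldNum_le_locDomNum G hG
  constructor
  · intro h
    by_contra hne
    have := locDomNum_le_of_mldNum_le hG (k := Fintype.card V - 3) (by omega) (by omega) (by omega)
    omega
  · intro h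
    exact (locDomNum_le_of_mldNum_le hG h.le (by omega) (by omega)).antisymm (h ▸ hle)
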